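/- For every pyramid partition Π = (Π_B, Π_W) of length m and every integer k ≥ 0, the sum over the set of weights W := { x_p : p ∈ AddP(Π) ∪ RemP(Π) } of the residues, ∑_{w ∈ W} Res_{z=w} ( z^k · h_Π(z) ), equals the coefficient of z^{−1} in the expansion of z^k · h_Π(z) as a formal Laurent series in z^{−1}, i.e. in the image of z^k·h_Π(z) under the canonical embedding K(z) ↪ K((z^{−1})). -/

import Mathlib

/-- A stone position `(a,b,j)` in the pyramid. -/
abbrev PyrPos : Type := ℕ × ℕ × ℕ

/-- `(a,b,j)` is a black position of the length-`m` empty room configuration: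
`a + b ≤ j ≤ m − 1`. -/
def IsBlackPos (m : ℕ) (p : PyrPos) : Prop :=
  p.1 + p.2.1 ≤ p.2.2 ∧ p.2.2 ≤ m - 1

/-- `(a,b,j)` is a white position of the length-`m` empty room configuration:
`a + b < j ≤ m − 1`. -/
def IsWhitePos (m : ℕ) (p : PyrPos) : Prop :=
  p.1 + p.2.1 < p.2.2 ∧ p.2.2 ≤ m - 1

/-- `(ΠB, ΠW)` is a pyramid partition of length `m`. -/
def IsPyramid (m : ℕ) (PB PW : Finset PyrPos) : Prop :=
  (∀ p ∈ PB, IsBlackPos m p) ∧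
  (∀ p ∈ PW, IsWhitePos m p) ∧
  (∀ p ∈ PB, 1 ≤ p.1 → (p.1 - 1, p.2.1, p.2.2) ∈ PW) ∧
  (∀ p ∈ PB, 1 ≤ p.2.1 → (p.1, p.2.1 - 1, p.2.2) ∈ PW) ∧
  (∀ p ∈ PW, p ∈ PB ∧ (p.1, p.2.1, p.2.2 - 1) ∈ PB)

/-- The field `K = ℚ(q, h, χ)` of rational functions in three indeterminates. -/
abbrev KP : Type := FractionRing (MvPolynomial (Fin 3) ℚ)

/-- The equivariant parameter `q`. -/
noncomputable def qP : KP := algebraMap (MvPolynomial (Fin 3) ℚ) KP (MvPolynomial.X 0)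

/-- The equivariant parameter `h`. -/
noncomputable def hP : KP := algebraMap (MvPolynomial (Fin 3) ℚ) KP (MvPolynomial.X 1)

/-- The framing parameter `χ`. -/
noncomputable def chiP : KP := algebraMap (MvPolynomial (Fin 3) ℚ) KP (MvPolynomial.X 2)

/-- The parameter `t := −q − h` (so `t + q + h = 0`). -/
noncomputable def tP : KP := -qP - hP

/-- The weight `x_p = χ + a·q + b·h + j·t` of a position `p = (a,b,j)`. -/
noncomputable def posWeight (p : PyrPos) : KP :=
  chiP + (p.1 : KP) * qP + (p.2.1 : KP) * hP + (p.2.2 : KP) * tP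

/-- The set of addible pairs of the pyramid partition `(ΠB, ΠW)`. -/
def AddPairs (m : ℕ) (PB PW : Finset PyrPos) : Set PyrPos :=
  { p | IsWhitePos m p ∧ p ∉ PB ∧ IsPyramid m (insert p PB) (insert p PW) }

/-- The set of removable pairs of the pyramid partition `(ΠB, ΠW)`. -/
def RemPairs (m : ℕ) (PB PW : Finset PyrPos) : Set PyrPos :=
  { p | p ∈ PW ∧ IsPyramid m (PB.erase p) (PW.erase p) }

/-- The rational function `h_Π(z) ∈ K(z)` attached to a pyramid partition
`Π = (ΠB, ΠW)` of length `m`. -/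
noncomputable def hPyr (m : ℕ) (PB PW : Finset PyrPos) : RatFunc KP :=
  (-1 : RatFunc KP) ^ (PB \ PW).card * (-1 : RatFunc KP) ^ (m + 1) *
    (RatFunc.X - RatFunc.C chiP - RatFunc.C ((m : KP) * tP)) *
    (∏ p ∈ PW,
      ((RatFunc.X - RatFunc.C (posWeight p) + RatFunc.C tP) *
        (RatFunc.X - RatFunc.C (posWeight p) + RatFunc.C qP) *
        (RatFunc.X - RatFunc.C (posWeight p) + RatFunc.C hP)) /
      ((RatFunc.X - RatFunc.C (posWeight p) - RatFunc.C tP) *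
        (RatFunc.X - RatFunc.C (posWeight p) - RatFunc.C qP) *
        (RatFunc.X - RatFunc.C (posWeight p) - RatFunc.C hP))) *
    ∏ p ∈ PB \ PW,
      ((RatFunc.X - RatFunc.C (posWeight p)) *
        (RatFunc.X - RatFunc.C (posWeight p) + RatFunc.C qP) *
        (RatFunc.X - RatFunc.C (posWeight p) + RatFunc.C hP)) /
      (RatFunc.X - RatFunc.C (posWeight p) - RatFunc.C tP)

/-- The residue at `z = a` of a rational function `f ∈ K(z)`: the coefficient of
`(z−a)⁻¹` in the Laurent expansion of `f` at `z = a`. -/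
noncomputable def resAtP (a : KP) (f : RatFunc KP) : KP :=
  ((RatFunc.laurent a f : RatFunc KP) : LaurentSeries KP).coeff (-1)

/-- The expansion of a rational function as a formal Laurent series in `z⁻¹`,
i.e. the canonical embedding `K(z) ↪ K((z⁻¹))`, realized inside `K((w))` by the
substitution `z = w⁻¹`; the coefficient of `z^{−m}` of `f` is `(expAtInfP f).coeff m`. -/
noncomputable def expAtInfP (f : RatFunc KP) : LaurentSeries KP :=
  RatFunc.eval (algebraMap KP (LaurentSeries KP))
    ((HahnSeries.single (1 : ℤ) (1 : KP))⁻¹) f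

section Residues

variable {F : Type*} [Field F]

theorem algebraMap_laurentSeries (c : F) :
    algebraMap F (LaurentSeries F) c = HahnSeries.C c := by
  rw [HahnSeries.algebraMap_apply']
  simp

/-- The coercion of power series to Laurent series commutes with inversion of units. -/
theorem ofPowerSeries_inv {g : PowerSeries F} (hg : PowerSeries.constantCoeff g ≠ 0) :
    HahnSeries.ofPowerSeries ℤ F g⁻¹ = (HahnSeries.ofPowerSeries ℤ F g)⁻¹ := by
  refine eq_inv_of_mul_eq_one_left ?_
  rw [← map_mul, PowerSeries.inv_mul_cancel _ hg, map_one]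

theorem coeff_neg_one_ofPowerSeries (g : PowerSeries F) :
    (HahnSeries.ofPowerSeries ℤ F g).coeff (-1) = 0 := by
  rw [PowerSeries.coeff_coe]
  simp

theorem coeff_one_ofPowerSeries (g : PowerSeries F) :
    (HahnSeries.ofPowerSeries ℤ F g).coeff 1 = PowerSeries.coeff 1 g := by
  rw [PowerSeries.coeff_coe]
  simp

/-- Residue of a rational function at `a`, as a linear map. -/
noncomputable def residue (a : F) : RatFunc F →ₗ[F] F where
  toFun f := ((RatFunc.laurent a f : RatFunc F) : LaurentSeries F).coeff (-1)
  map_add' f g := by simp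
  map_smul' c f := by
    have : ((RatFunc.C c : RatFunc F) : LaurentSeries F) = HahnSeries.C c := by
      rw [← RatFunc.algebraMap_C, ← IsScalarTower.algebraMap_apply]
      simp
    rw [map_smul, RatFunc.smul_eq_C_mul, map_mul, this, HahnSeries.C_mul_eq_smul]
    simp

theorem residue_algebraMap (a : F) (p : Polynomial F) :
    residue a (algebraMap (Polynomial F) (RatFunc F) p) = 0 := by
  change ((RatFunc.laurent a _ : RatFunc F) : LaurentSeries F).coeff (-1) = 0
  rw [RatFunc.laurent_algebraMap]
  have := RatFunc.coe_coe (Polynomial.taylor a p)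
  rw [RatFunc.coePolynomial] at this
  rw [← this, coeff_neg_one_ofPowerSeries]

open scoped Classical in
theorem residue_inv_pow (a b : F) (n : ℕ) :
    residue a (((RatFunc.X - RatFunc.C b)⁻¹) ^ (n + 1) : RatFunc F) =
      if a = b ∧ n = 0 then 1 else 0 := by
  change ((RatFunc.laurent a _ : RatFunc F) : LaurentSeries F).coeff (-1) = _
  have hC (c : F) : ((RatFunc.C c : RatFunc F) : LaurentSeries F) =
      HahnSeries.ofPowerSeries ℤ F (PowerSeries.C c) := by
    rw [← RatFunc.algebraMap_C, ← IsScalarTower.algebraMap_apply]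
    simp
  have key : ((RatFunc.laurent a ((RatFunc.X - RatFunc.C b)⁻¹ ^ (n + 1)) : RatFunc F) :
      LaurentSeries F) =
      (HahnSeries.ofPowerSeries ℤ F ((PowerSeries.X + PowerSeries.C (a - b)) ^ (n + 1)))⁻¹ := by
    simp only [map_pow, map_inv₀, map_sub, RatFunc.laurent_X, RatFunc.laurent_C, map_add, hC,
      RatFunc.coe_X, HahnSeries.ofPowerSeries_X, inv_pow]
    rw [add_sub_assoc]
  rw [key]
  by_cases hab : a = b
  · subst hab
    simp only [sub_self, map_zero, add_zero, true_and, HahnSeries.ofPowerSeries_X_pow]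
    rw [HahnSeries.inv_single, HahnSeries.coeff_single]
    simp only [inv_one]
    congr 1
    simp
  · rw [← ofPowerSeries_inv, coeff_neg_one_ofPowerSeries, if_neg (fun h => hab h.1)]
    simpa using sub_ne_zero.mpr hab

theorem coeff_eval₂_single_neg_one (p : Polynomial F) (n : ℕ) :
    (p.eval₂ (algebraMap F (LaurentSeries F)) (HahnSeries.single (1 : ℤ) (1 : F))⁻¹).coeff
      (-(n : ℤ)) = p.coeff n := by
  rw [Polynomial.eval₂_eq_sum_range, HahnSeries.coeff_sum]
  have h (i : ℕ) : (algebraMap F (LaurentSeries F) (p.coeff i) *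
      (HahnSeries.single (1 : ℤ) (1 : F))⁻¹ ^ i).coeff (-(n : ℤ)) =
      if n = i then p.coeff i else 0 := by
    rw [HahnSeries.inv_single, HahnSeries.single_pow, algebraMap_laurentSeries, HahnSeries.C_mul_eq_smul,
    HahnSeries.coeff_smul,
      HahnSeries.coeff_single]
    simp
  simp only [h]
  rw [Finset.sum_ite_eq]
  split_ifs with hn
  · rfl
  · rw [Polynomial.coeff_eq_zero_of_natDegree_lt]
    simpa using hn

theorem coeff_one_eval₂_single_neg_one (p : Polynomial F) :
    (p.eval₂ (algebraMap F (LaurentSeries F)) (HahnSeries.single (1 : ℤ) (1 : F))⁻¹).coeff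
      1 = 0 := by
  rw [Polynomial.eval₂_eq_sum_range, HahnSeries.coeff_sum]
  refine Finset.sum_eq_zero fun i _ => ?_
  rw [HahnSeries.inv_single, HahnSeries.single_pow, algebraMap_laurentSeries, HahnSeries.C_mul_eq_smul,
    HahnSeries.coeff_smul,
    HahnSeries.coeff_single_of_ne, smul_zero]
  simp
  omega

theorem eval₂_single_neg_one_ne_zero {p : Polynomial F} (hp : p ≠ 0) :
    p.eval₂ (algebraMap F (LaurentSeries F)) (HahnSeries.single (1 : ℤ) (1 : F))⁻¹ ≠ 0 := by
  intro h
  refine hp (Polynomial.ext fun n => ?_)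
  rw [← coeff_eval₂_single_neg_one, h]
  simp

/-- The embedding `F(z) → F((z⁻¹))` as a ring homomorphism. -/
noncomputable def expandAtInfinity : RatFunc F →+* LaurentSeries F :=
  RatFunc.liftRingHom (Polynomial.eval₂RingHom (algebraMap F (LaurentSeries F))
    (HahnSeries.single (1 : ℤ) (1 : F))⁻¹) fun _ hp =>
      mem_nonZeroDivisors_of_ne_zero (eval₂_single_neg_one_ne_zero (nonZeroDivisors.ne_zero hp))

theorem expandAtInfinity_apply (f : RatFunc F) :
    expandAtInfinity f = RatFunc.eval (algebraMap F (LaurentSeries F))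
      (HahnSeries.single (1 : ℤ) (1 : F))⁻¹ f := by
  exact RatFunc.liftRingHom_apply _ _ f

theorem expandAtInfinity_algebraMap (p : Polynomial F) :
    expandAtInfinity (algebraMap (Polynomial F) (RatFunc F) p) =
      p.eval₂ (algebraMap F (LaurentSeries F)) (HahnSeries.single (1 : ℤ) (1 : F))⁻¹ := by
  rw [expandAtInfinity_apply, RatFunc.eval_algebraMap]
  rfl

theorem coeff_one_expandAtInfinity_inv_pow (b : F) (n : ℕ) :
    (expandAtInfinity (((RatFunc.X - RatFunc.C b)⁻¹) ^ (n + 1) : RatFunc F)).coeff 1 =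
      if n = 0 then 1 else 0 := by
  have hg : PowerSeries.constantCoeff
      ((1 - PowerSeries.C b * PowerSeries.X) ^ (n + 1) : PowerSeries F) ≠ 0 := by simp
  have key : expandAtInfinity (((RatFunc.X - RatFunc.C b)⁻¹) ^ (n + 1) : RatFunc F) =
      HahnSeries.ofPowerSeries ℤ F (PowerSeries.X ^ (n + 1) *
        ((1 - PowerSeries.C b * PowerSeries.X) ^ (n + 1))⁻¹) := by
    rw [map_mul, ofPowerSeries_inv hg]
    have h : expandAtInfinity (RatFunc.X - RatFunc.C b : RatFunc F) =
        (HahnSeries.single (1 : ℤ) (1 : F))⁻¹ - HahnSeries.C b := by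
      rw [map_sub, expandAtInfinity_apply, expandAtInfinity_apply, RatFunc.eval_X, RatFunc.eval_C,
        algebraMap_laurentSeries]
    have hs : HahnSeries.single (1 : ℤ) (1 : F) ≠ 0 := by simp
    rw [map_pow, map_inv₀, h]
    simp only [map_pow, map_sub, map_mul, map_one, HahnSeries.ofPowerSeries_X,
      HahnSeries.ofPowerSeries_C]
    rw [← inv_pow, ← mul_pow, ← div_eq_mul_inv,
      show (1 : LaurentSeries F) - HahnSeries.C b * HahnSeries.single 1 1 =
        HahnSeries.single 1 1 * ((HahnSeries.single 1 1)⁻¹ - HahnSeries.C b) by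
          rw [mul_sub, mul_inv_cancel₀ hs, mul_comm]]
    rw [div_mul_cancel_left₀ hs]
  rw [key, coeff_one_ofPowerSeries, PowerSeries.coeff_X_pow_mul']
  rcases n with _ | n
  · simp
  · simp

/-- Residue theorem on the projective line: the sum of the residues over a finite set containing
all finite poles is the coefficient of `z⁻¹` at infinity. -/
theorem sum_residue_eq_coeff_expandAtInfinity (f : RatFunc F) (T : Finset F)
    (hs : f.denom.Splits) (hT : ∀ a, f.denom.IsRoot a → a ∈ T) :
    ∑ a ∈ T, residue a f = (expandAtInfinity f).coeff 1 := by
  classical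
  have hden : f.denom = ∏ a ∈ T, (Polynomial.X - Polynomial.C a) ^ f.denom.rootMultiplicity a := by
    conv_lhs => rw [hs.eq_prod_roots_of_monic (RatFunc.monic_denom f)]
    rw [Finset.prod_multiset_map_count]
    simp only [Polynomial.count_roots]
    refine Finset.prod_subset (fun a ha => hT a ?_) fun a _ ha => ?_
    · exact (Polynomial.mem_roots'.mp (Multiset.mem_toFinset.mp ha)).2
    · rw [Multiset.mem_toFinset, ← Multiset.count_eq_zero, Polynomial.count_roots] at ha
      rw [ha, pow_zero]
  have hX (a : F) : algebraMap (Polynomial F) (RatFunc F) (Polynomial.X - Polynomial.C a) =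
      RatFunc.X - RatFunc.C a := by simp
  obtain ⟨q, r, hr, hf⟩ := Polynomial.mul_prod_pow_inverse_eq_quo_add_sum_rem_mul_pow_inverse
    (K := RatFunc F) (s := T) f.num (g := fun a => Polynomial.X - Polynomial.C a)
    (fun a _ => Polynomial.monic_X_sub_C a)
    (fun a _ b _ hab => Polynomial.pairwise_coprime_X_sub_C Function.injective_id hab)
    (fun a => f.denom.rootMultiplicity a)
    (gi := fun a => (RatFunc.X - RatFunc.C a)⁻¹)
    (fun a _ => by
      rw [hX, inv_mul_cancel₀]
      rw [← hX]
      exact RatFunc.algebraMap_ne_zero (Polynomial.X_sub_C_ne_zero a))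
  have hfeq : f = algebraMap (Polynomial F) (RatFunc F) q + ∑ a ∈ T,
      ∑ j : Fin (f.denom.rootMultiplicity a),
        (r a j).coeff 0 • ((RatFunc.X - RatFunc.C a)⁻¹ ^ (j.1 + 1) : RatFunc F) := by
    conv_lhs => rw [← RatFunc.num_div_denom f, hden]
    rw [map_prod, div_eq_mul_inv, ← Finset.prod_inv_distrib]
    simp only [map_pow, hX, ← inv_pow]
    rw [hf]
    congr 1
    refine Finset.sum_congr rfl fun a ha => Finset.sum_congr rfl fun j _ => ?_
    have hdeg := hr a ha j
    rw [Polynomial.degree_X_sub_C] at hdeg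
    rw [Polynomial.eq_C_of_degree_le_zero (Order.le_of_lt_succ (a := (r a j).degree)
      (b := (0 : WithBot ℕ)) hdeg), RatFunc.smul_eq_C_mul]
    simp
  have hR : ∀ a ∈ T, residue a f = ∑ j : Fin (f.denom.rootMultiplicity a),
      (r a j).coeff 0 * if j.1 = 0 then 1 else 0 := by
    intro b hb
    conv_lhs => rw [hfeq]
    simp only [map_add, map_sum, map_smul, residue_algebraMap, residue_inv_pow, zero_add,
      smul_eq_mul]
    rw [Finset.sum_eq_single b]
    · simp
    · intro a _ hab
      simp [hab.symm]
    · exact fun h => absurd hb h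
  have hE (c : F) (x : RatFunc F) : (expandAtInfinity (c • x)).coeff 1 =
      c * (expandAtInfinity x).coeff 1 := by
    rw [RatFunc.smul_eq_C_mul, map_mul, expandAtInfinity_apply (RatFunc.C c), RatFunc.eval_C,
      algebraMap_laurentSeries, HahnSeries.C_mul_eq_smul,
    HahnSeries.coeff_smul, smul_eq_mul]
  rw [Finset.sum_congr rfl hR]
  conv_rhs => rw [hfeq]
  simp only [map_add, map_sum, HahnSeries.coeff_add, HahnSeries.coeff_sum, hE,
    coeff_one_expandAtInfinity_inv_pow, expandAtInfinity_algebraMap,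
    coeff_one_eval₂_single_neg_one, zero_add]

end Residues

section Combinatorics

theorem Finset.mem_iff_lt_card_of_isLowerSet {s : Finset ℕ}
    (hs : ∀ i, i + 1 ∈ s → i ∈ s) (i : ℕ) : i ∈ s ↔ i < s.card := by
  have hle : ∀ n k, n + k ∈ s → n ∈ s := by
    intro n k
    induction k with
    | zero => exact id
    | succ k ih => exact fun h => ih (hs _ h)
  constructor
  · intro hi
    have hsub : Finset.range (i + 1) ⊆ s := fun n hn => by
      have hn' := Finset.mem_range.mp hn
      exact hle n (i - n) (by rwa [Nat.add_sub_cancel' (by omega)])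
    simpa using Finset.card_le_card hsub
  · intro hi
    by_contra hmem
    have hsub : s ⊆ Finset.range i := fun n hn => by
      by_contra hin
      have hin' : i ≤ n := by simpa using hin
      exact hmem (hle i (n - i) (by rwa [Nat.add_sub_cancel' hin']))
    have := Finset.card_le_card hsub
    rw [Finset.card_range] at this
    omega

/-- The number of positions `(a,b,j)` of `P` with `j - a = A` and `j - b = B`. -/
def lineCount (P : Finset PyrPos) (A B : ℤ) : ℕ :=
  (P.filter fun p => (p.2.2 : ℤ) - p.1 = A ∧ (p.2.2 : ℤ) - p.2.1 = B).card

/-- `P` is closed under diagonal descent, with all coordinates bounded by the last one. -/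
structure IsDiagonalLower (P : Finset PyrPos) : Prop where
  descend : ∀ a b j, (a + 1, b + 1, j + 1) ∈ P → (a, b, j) ∈ P
  le_height : ∀ a b j, (a, b, j) ∈ P → a ≤ j ∧ b ≤ j

variable {P : Finset PyrPos}

theorem IsDiagonalLower.mem_iff (hP : IsDiagonalLower P) {a b j : ℕ} {A B : ℤ}
    (hA : (j : ℤ) - a = A) (hB : (j : ℤ) - b = B) :
    (a, b, j) ∈ P ↔ min a b < lineCount P A B := by
  set L := P.filter fun p => (p.2.2 : ℤ) - p.1 = A ∧ (p.2.2 : ℤ) - p.2.1 = B with hL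
  have hinj : Set.InjOn (fun p : PyrPos => min p.1 p.2.1) (L : Set PyrPos) := by
    rintro ⟨a₁, b₁, j₁⟩ h₁ ⟨a₂, b₂, j₂⟩ h₂ h
    simp only [hL, Finset.coe_filter, Set.mem_ofPred_eq] at h₁ h₂ h
    simp only [Prod.mk.injEq]
    omega
  have hcard : lineCount P A B = (L.image fun p : PyrPos => min p.1 p.2.1).card :=
    (Finset.card_image_of_injOn hinj).symm
  rw [hcard, ← Finset.mem_iff_lt_card_of_isLowerSet]
  · simp only [hL, Finset.mem_image, Finset.mem_filter, Prod.exists]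
    constructor
    · exact fun h => ⟨a, b, j, ⟨h, hA, hB⟩, rfl⟩
    · rintro ⟨a', b', j', ⟨h, hA', hB'⟩, hmin⟩
      obtain rfl : a' = a := by omega
      obtain rfl : b' = b := by omega
      obtain rfl : j' = j := by omega
      exact h
  · simp only [hL, Finset.mem_image, Finset.mem_filter, Prod.exists]
    rintro i ⟨a', b', j', ⟨h, hA', hB'⟩, hmin⟩
    have hle := hP.le_height _ _ _ h
    obtain ⟨a', rfl⟩ := Nat.exists_eq_succ_of_ne_zero (show a' ≠ 0 by omega)
    obtain ⟨b', rfl⟩ := Nat.exists_eq_succ_of_ne_zero (show b' ≠ 0 by omega)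
    obtain ⟨j', rfl⟩ := Nat.exists_eq_succ_of_ne_zero (show j' ≠ 0 by omega)
    exact ⟨a', b', j', ⟨hP.descend _ _ _ h, by push_cast at hA'; omega,
      by push_cast at hB'; omega⟩, by omega⟩

theorem exists_pos_on_line {A B : ℤ} (hA : 0 ≤ A) (hB : 0 ≤ B) (i : ℕ) :
    ∃ a b j : ℕ, (j : ℤ) - a = A ∧ (j : ℤ) - b = B ∧ min a b = i :=
  ⟨i + (B - A).toNat, i + (A - B).toNat, i + (max A B).toNat, by omega, by omega, by omega⟩

theorem IsDiagonalLower.exists_top (hP : IsDiagonalLower P) {A B : ℤ}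
    (h : 0 < lineCount P A B) :
    ∃ a b j : ℕ, (a, b, j) ∈ P ∧ (j : ℤ) - a = A ∧ (j : ℤ) - b = B ∧
      min a b + 1 = lineCount P A B := by
  obtain ⟨⟨a₀, b₀, j₀⟩, h₀⟩ := Finset.card_pos.mp h
  simp only [Finset.mem_filter] at h₀
  have hle := hP.le_height _ _ _ h₀.1
  obtain ⟨a, b, j, hA, hB, hmin⟩ := exists_pos_on_line (A := A) (B := B) (by omega) (by omega)
    (lineCount P A B - 1)
  exact ⟨a, b, j, (hP.mem_iff hA hB).mpr (by omega), hA, hB, by omega⟩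

variable {m : ℕ} {PB PW : Finset PyrPos}

namespace IsPyramid

theorem black_pos (h : IsPyramid m PB PW) {a b j : ℕ} (hp : (a, b, j) ∈ PB) :
    a + b ≤ j ∧ j ≤ m - 1 := h.1 _ hp

theorem white_pos (h : IsPyramid m PB PW) {a b j : ℕ} (hp : (a, b, j) ∈ PW) :
    a + b < j ∧ j ≤ m - 1 := h.2.1 _ hp

theorem white_of_black_fst (h : IsPyramid m PB PW) {a b j : ℕ} (hp : (a + 1, b, j) ∈ PB) :
    (a, b, j) ∈ PW := h.2.2.1 _ hp (Nat.le_add_left 1 a)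

theorem white_of_black_snd (h : IsPyramid m PB PW) {a b j : ℕ} (hp : (a, b + 1, j) ∈ PB) :
    (a, b, j) ∈ PW := h.2.2.2.1 _ hp (Nat.le_add_left 1 b)

theorem black_of_white (h : IsPyramid m PB PW) {a b j : ℕ} (hp : (a, b, j) ∈ PW) :
    (a, b, j) ∈ PB := (h.2.2.2.2 _ hp).1

theorem black_of_white_below (h : IsPyramid m PB PW) {a b j : ℕ} (hp : (a, b, j + 1) ∈ PW) :
    (a, b, j) ∈ PB := (h.2.2.2.2 _ hp).2

theorem isDiagonalLower_black (h : IsPyramid m PB PW) : IsDiagonalLower PB where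
  descend _ _ _ hp := h.black_of_white (h.white_of_black_snd
    (h.black_of_white_below (h.white_of_black_fst hp)))
  le_height a b j hp := by have := h.black_pos hp; omega

theorem isDiagonalLower_white (h : IsPyramid m PB PW) : IsDiagonalLower PW where
  descend _ _ _ hp := h.white_of_black_snd (h.black_of_white (h.white_of_black_fst
    (h.black_of_white_below hp)))
  le_height a b j hp := by have := h.white_pos hp; omega

theorem lineCount_black_le_fst (h : IsPyramid m PB PW) {A A' B : ℤ} (hA : A' = A + 1) :
    (lineCount PB A B : ℤ) ≤ lineCount PW A' B + if B ≤ A then 1 else 0 := by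
  rcases Nat.eq_zero_or_pos (lineCount PB A B) with h0 | h0
  · split_ifs <;> omega
  obtain ⟨a, b, j, hp, h₁, h₂, hmin⟩ := h.isDiagonalLower_black.exists_top h0
  rcases a with _ | a
  · split_ifs <;> omega
  · have := (h.isDiagonalLower_white.mem_iff (A := A') (B := B) (by push_cast at h₁; omega)
      h₂).mp (h.white_of_black_fst hp)
    push_cast at h₁
    split_ifs <;> omega

theorem lineCount_black_le_snd (h : IsPyramid m PB PW) {A B B' : ℤ} (hB : B' = B + 1) :
    (lineCount PB A B : ℤ) ≤ lineCount PW A B' + if A ≤ B then 1 else 0 := by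
  rcases Nat.eq_zero_or_pos (lineCount PB A B) with h0 | h0
  · split_ifs <;> omega
  obtain ⟨a, b, j, hp, h₁, h₂, hmin⟩ := h.isDiagonalLower_black.exists_top h0
  rcases b with _ | b
  · split_ifs <;> omega
  · have := (h.isDiagonalLower_white.mem_iff (A := A) (B := B') h₁
      (by push_cast at h₂; omega)).mp (h.white_of_black_snd hp)
    push_cast at h₂
    split_ifs <;> omega

theorem lineCount_white_le (h : IsPyramid m PB PW) (A B : ℤ) :
    lineCount PW A B ≤ lineCount PB A B :=
  Finset.card_le_card (Finset.filter_subset_filter _ fun _ hp => h.black_of_white hp)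

theorem lineCount_white_le_below (h : IsPyramid m PB PW) {A A' B B' : ℤ} (hA : A' = A + 1)
    (hB : B' = B + 1) : lineCount PW A' B' ≤ lineCount PB A B := by
  rcases Nat.eq_zero_or_pos (lineCount PW A' B') with h0 | h0
  · omega
  obtain ⟨a, b, j, hp, h₁, h₂, hmin⟩ := h.isDiagonalLower_white.exists_top h0
  have hpos := h.white_pos hp
  obtain ⟨j, rfl⟩ := Nat.exists_eq_succ_of_ne_zero (show j ≠ 0 by omega)
  have := (h.isDiagonalLower_black.mem_iff (A := A) (B := B) (by push_cast at h₁; omega)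
    (by push_cast at h₂; omega)).mp (h.black_of_white_below hp)
  omega

theorem line_bounds (h : IsPyramid m PB PW) (hm : 1 ≤ m) {A B : ℤ}
    (h0 : 0 < lineCount PB A B) : 0 ≤ A ∧ 0 ≤ B ∧ A ≤ m - 1 ∧ B ≤ m - 1 := by
  obtain ⟨a, b, j, hp, h₁, h₂, -⟩ := h.isDiagonalLower_black.exists_top h0
  have := h.black_pos hp
  omega

theorem insert_pair (h : IsPyramid m PB PW) {a b j : ℕ} (hw : a + b < j ∧ j ≤ m - 1)
    (h₁ : 1 ≤ a → (a - 1, b, j) ∈ PW) (h₂ : 1 ≤ b → (a, b - 1, j) ∈ PW)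
    (h₃ : (a, b, j - 1) ∈ PB) :
    IsPyramid m (insert (a, b, j) PB) (insert (a, b, j) PW) := by
  obtain ⟨i₁, i₂, i₃, i₄, i₅⟩ := h
  simp only [IsPyramid, Finset.forall_mem_insert]
  refine ⟨⟨⟨hw.1.le, hw.2⟩, i₁⟩, ⟨hw, i₂⟩, ⟨fun ha => Finset.mem_insert_of_mem (h₁ ha),
    fun p hp ha => Finset.mem_insert_of_mem (i₃ p hp ha)⟩,
    ⟨fun hb => Finset.mem_insert_of_mem (h₂ hb),
    fun p hp hb => Finset.mem_insert_of_mem (i₄ p hp hb)⟩,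
    ⟨Finset.mem_insert_self _ _, Finset.mem_insert_of_mem h₃⟩, fun p hp =>
    ⟨Finset.mem_insert_of_mem (i₅ p hp).1, Finset.mem_insert_of_mem (i₅ p hp).2⟩⟩

theorem erase_pair (h : IsPyramid m PB PW) {a b j : ℕ} (h₁ : (a + 1, b, j) ∉ PB)
    (h₂ : (a, b + 1, j) ∉ PB) (h₃ : (a, b, j + 1) ∉ PW) :
    IsPyramid m (PB.erase (a, b, j)) (PW.erase (a, b, j)) := by
  simp only [IsPyramid, Finset.mem_erase, Prod.forall, ne_eq, Prod.mk.injEq]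
  refine ⟨fun a' b' j' hp => h.1 _ hp.2, fun a' b' j' hp => h.2.1 _ hp.2, ?_, ?_, ?_⟩
  · rintro a' b' j' ⟨-, hp⟩ ha
    refine ⟨?_, h.2.2.1 _ hp ha⟩
    rintro ⟨hx, rfl, rfl⟩
    obtain rfl : a' = a + 1 := by omega
    exact h₁ hp
  · rintro a' b' j' ⟨-, hp⟩ hb
    refine ⟨?_, h.2.2.2.1 _ hp hb⟩
    rintro ⟨rfl, hx, rfl⟩
    obtain rfl : b' = b + 1 := by omega
    exact h₂ hp
  · rintro a' b' j' ⟨hne, hp⟩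
    refine ⟨⟨hne, h.black_of_white hp⟩, ?_, (h.2.2.2.2 _ hp).2⟩
    rintro ⟨rfl, rfl, hx⟩
    have := h.white_pos hp
    obtain rfl : j' = j + 1 := by omega
    exact h₃ hp

theorem exists_mem_addPairs (h : IsPyramid m PB PW) {A B : ℤ}
    (hA : 1 ≤ A ∧ A ≤ m - 1) (hB : 1 ≤ B ∧ B ≤ m - 1)
    (hbelow : lineCount PB A B < lineCount PB (A - 1) (B - 1))
    (hfst : 0 < lineCount PB A B + max A B - A →
      (lineCount PB A B : ℤ) + 1 ≤ lineCount PW (A + 1) B + if B ≤ A then 1 else 0)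
    (hsnd : 0 < lineCount PB A B + max A B - B →
      (lineCount PB A B : ℤ) + 1 ≤ lineCount PW A (B + 1) + if A ≤ B then 1 else 0) :
    ∃ p ∈ AddPairs m PB PW, (p.2.2 : ℤ) - p.1 = A ∧ (p.2.2 : ℤ) - p.2.1 = B := by
  obtain ⟨a, b, j, h₁, h₂, hmin⟩ := exists_pos_on_line (A := A) (B := B) (by omega) (by omega)
    (lineCount PB A B)
  have hfst' : 1 ≤ a → (a - 1, b, j) ∈ PW := fun ha => by
    refine (h.isDiagonalLower_white.mem_iff (A := A + 1) (B := B) (by omega) h₂).mpr ?_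
    have := hfst (by omega)
    split_ifs at this <;> omega
  have hsnd' : 1 ≤ b → (a, b - 1, j) ∈ PW := fun hb => by
    refine (h.isDiagonalLower_white.mem_iff (A := A) (B := B + 1) h₁ (by omega)).mpr ?_
    have := hsnd (by omega)
    split_ifs at this <;> omega
  have hbelow' : (a, b, j - 1) ∈ PB :=
    (h.isDiagonalLower_black.mem_iff (A := A - 1) (B := B - 1) (by omega) (by omega)).mpr
      (by omega)
  have hw : a + b < j ∧ j ≤ m - 1 := by
    have := h.black_pos hbelow'
    refine ⟨by omega, ?_⟩
    by_cases ha : 1 ≤ a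
    · exact (h.white_pos (hfst' ha)).2
    by_cases hb : 1 ≤ b
    · exact (h.white_pos (hsnd' hb)).2
    omega
  refine ⟨(a, b, j), ⟨hw, ?_, h.insert_pair hw hfst' hsnd' hbelow'⟩, h₁, h₂⟩
  rw [h.isDiagonalLower_black.mem_iff h₁ h₂]
  omega

theorem exists_mem_remPairs (h : IsPyramid m PB PW) {A B : ℤ}
    (hpos : 0 < lineCount PW A B)
    (habove : lineCount PW (A + 1) (B + 1) < lineCount PW A B)
    (hfst : (lineCount PB (A - 1) B : ℤ) ≤
      lineCount PW A B - 1 + if B ≤ A - 1 then 1 else 0)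
    (hsnd : (lineCount PB A (B - 1) : ℤ) ≤
      lineCount PW A B - 1 + if A ≤ B - 1 then 1 else 0) :
    ∃ p ∈ RemPairs m PB PW, (p.2.2 : ℤ) - p.1 = A ∧ (p.2.2 : ℤ) - p.2.1 = B := by
  obtain ⟨a, b, j, hp, h₁, h₂, hmin⟩ := h.isDiagonalLower_white.exists_top hpos
  refine ⟨(a, b, j), ⟨hp, h.erase_pair ?_ ?_ ?_⟩, h₁, h₂⟩
  · rw [h.isDiagonalLower_black.mem_iff (A := A - 1) (B := B) (by push_cast; omega) h₂]
    split_ifs at hfst <;> omega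
  · rw [h.isDiagonalLower_black.mem_iff (A := A) (B := B - 1) h₁ (by push_cast; omega)]
    split_ifs at hsnd <;> omega
  · rw [h.isDiagonalLower_white.mem_iff (A := A + 1) (B := B + 1) (by push_cast; omega)
      (by push_cast; omega)]
    omega

set_option maxHeartbeats 2000000 in
/-- If the order of vanishing of `h_Π` at `χ - A q - B h` is negative, then this point is the
weight of an addible or removable pair. -/
theorem exists_mem_of_order_neg (h : IsPyramid m PB PW) (hm : 1 ≤ m) {A B : ℤ}
    (hord : (if A = m ∧ B = m then (1 : ℤ) else 0) + lineCount PW (A + 1) (B + 1)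
      + lineCount PB A B + lineCount PB (A - 1) B + lineCount PB A (B - 1)
      < lineCount PW A B + lineCount PW (A + 1) B + lineCount PW A (B + 1)
        + lineCount PB (A - 1) (B - 1)) :
    ∃ p ∈ AddPairs m PB PW ∪ RemPairs m PB PW,
      (p.2.2 : ℤ) - p.1 = A ∧ (p.2.2 : ℤ) - p.2.1 = B := by
  have h1 := h.lineCount_white_le A B
  have h2 := h.lineCount_white_le_below (A := A - 1) (A' := A) (B := B - 1) (B' := B)
    (by omega) (by omega)
  have h3 := h.lineCount_white_le_below (A := A) (B := B) rfl rfl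
  have h4 := h.lineCount_white_le_below (A := A) (A' := A + 1) (B := B - 1) (B' := B)
    (by omega) (by omega)
  have h5 := h.lineCount_white_le_below (A := A - 1) (A' := A) (B := B) (B' := B + 1)
    (by omega) (by omega)
  have e1 := h.lineCount_black_le_fst (A := A) (B := B) rfl
  have e2 := h.lineCount_black_le_snd (A := A) (B := B) rfl
  have e3 := h.lineCount_black_le_fst (A := A - 1) (A' := A) (B := B) (by omega)
  have e4 := h.lineCount_black_le_snd (A := A) (B := B - 1) (B' := B) (by omega)
  have e5 := h.lineCount_black_le_fst (A := A - 1) (A' := A) (B := B - 1) (by omega)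
  have e6 := h.lineCount_black_le_snd (A := A - 1) (B := B - 1) (B' := B) (by omega)
  have e7 := h.lineCount_white_le A (B - 1)
  have e8 := h.lineCount_white_le (A - 1) B
  have e9 := h.lineCount_black_le_snd (A := A + 1) (B := B) rfl
  have e10 := h.lineCount_black_le_fst (A := A) (B := B + 1) rfl
  have e11 := h.lineCount_white_le (A + 1) B
  have e12 := h.lineCount_white_le A (B + 1)
  have b2 := h.line_bounds hm (A := A - 1) (B := B - 1)
  have b3 := h.line_bounds hm (A := A - 1) (B := B)
  have b4 := h.line_bounds hm (A := A) (B := B - 1)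
  have b5 := h.line_bounds hm (A := A + 1) (B := B)
  have b6 := h.line_bounds hm (A := A) (B := B + 1)
  have key : (0 < lineCount PW A B ∧
      lineCount PW (A + 1) (B + 1) < lineCount PW A B ∧
      (lineCount PB (A - 1) B : ℤ) ≤ lineCount PW A B - 1 + (if B ≤ A - 1 then 1 else 0) ∧
      (lineCount PB A (B - 1) : ℤ) ≤ lineCount PW A B - 1 + if A ≤ B - 1 then 1 else 0) ∨
      ((1 ≤ A ∧ A ≤ m - 1) ∧ (1 ≤ B ∧ B ≤ m - 1) ∧
      lineCount PB A B < lineCount PB (A - 1) (B - 1) ∧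
      (0 < lineCount PB A B + max A B - A →
        (lineCount PB A B : ℤ) + 1 ≤ lineCount PW (A + 1) B + if B ≤ A then 1 else 0) ∧
      (0 < lineCount PB A B + max A B - B →
        (lineCount PB A B : ℤ) + 1 ≤ lineCount PW A (B + 1) + if A ≤ B then 1 else 0)) := by
    split_ifs at * <;> omega
  rcases key with ⟨k₁, k₂, k₃, k₄⟩ | ⟨k₁, k₂, k₃, k₄, k₅⟩
  · obtain ⟨p, hp, hpAB⟩ := h.exists_mem_remPairs k₁ k₂ k₃ k₄
    exact ⟨p, Or.inr hp, hpAB⟩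
  · obtain ⟨p, hp, hpAB⟩ := h.exists_mem_addPairs k₁ k₂ k₃ k₄ k₅
    exact ⟨p, Or.inl hp, hpAB⟩

end IsPyramid

end Combinatorics

section Poles

theorem sum_residue_eq_coeff_of_rootMultiplicity_le {F : Type*} [Field F] {N D : Polynomial F}
    (hN : N ≠ 0) (hD : D ≠ 0) (hs : D.Splits) (T : Finset F)
    (hT : ∀ a, D.rootMultiplicity a ≤ N.rootMultiplicity a ∨ a ∈ T) {f : RatFunc F}
    (hf : f = algebraMap (Polynomial F) (RatFunc F) N / algebraMap (Polynomial F) (RatFunc F) D) :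
    ∑ a ∈ T, residue a f = (expandAtInfinity f).coeff 1 := by
  have hdvd : f.denom ∣ D := hf ▸ RatFunc.denom_div_dvd N D
  refine sum_residue_eq_coeff_expandAtInfinity f T (hs.of_dvd hD hdvd) fun a ha => ?_
  refine (hT a).resolve_left fun hle => ?_
  have hmul : f.num * D = N * f.denom := (RatFunc.num_mul_eq_mul_denom_iff hD).mpr hf
  have hden := RatFunc.denom_ne_zero f
  have hnum : f.num ≠ 0 := fun h => mul_ne_zero hN hden (by rw [← hmul, h, zero_mul])
  have hmult := congrArg (Polynomial.rootMultiplicity a) hmul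
  rw [Polynomial.rootMultiplicity_mul (mul_ne_zero hnum hD),
    Polynomial.rootMultiplicity_mul (mul_ne_zero hN hden)] at hmult
  have hpos := (Polynomial.rootMultiplicity_pos hden).mpr ha
  have hnum0 : f.num.rootMultiplicity a = 0 := by
    refine Polynomial.rootMultiplicity_eq_zero fun hroot => ?_
    obtain ⟨u, v, huv⟩ := RatFunc.isCoprime_num_denom f
    have := congrArg (Polynomial.eval a) huv
    rw [Polynomial.eval_add, Polynomial.eval_mul, Polynomial.eval_mul, hroot.eq_zero, ha.eq_zero]
      at this
    simp at this
  omega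

theorem Polynomial.rootMultiplicity_prod {F ι : Type*} [Field F] (a : F) (s : Finset ι)
    (g : ι → Polynomial F) (hg : ∀ i ∈ s, g i ≠ 0) :
    (∏ i ∈ s, g i).rootMultiplicity a = ∑ i ∈ s, (g i).rootMultiplicity a := by
  classical
  induction s using Finset.induction_on with
  | empty => simp [Polynomial.rootMultiplicity_eq_zero]
  | insert i s hi ih =>
    have hg' : ∀ j ∈ s, g j ≠ 0 := fun j hj => hg j (Finset.mem_insert_of_mem hj)
    rw [Finset.prod_insert hi, Finset.sum_insert hi, Polynomial.rootMultiplicity_mul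
      (mul_ne_zero (hg i (Finset.mem_insert_self _ _)) (Finset.prod_ne_zero_iff.mpr hg')), ih hg']

theorem Polynomial.rootMultiplicity_X_sub_C_mul₃ {F : Type*} [Field F] [DecidableEq F]
    (a x y z : F) :
    ((X - C x) * (X - C y) * (X - C z)).rootMultiplicity a =
      (if a = x then 1 else 0) + (if a = y then 1 else 0) + if a = z then 1 else 0 := by
  have hne (b : F) : (X - C b : Polynomial F) ≠ 0 := X_sub_C_ne_zero b
  rw [rootMultiplicity_mul (mul_ne_zero (mul_ne_zero (hne x) (hne y)) (hne z)),
    rootMultiplicity_mul (mul_ne_zero (hne x) (hne y))]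
  simp only [rootMultiplicity_X_sub_C]

/-- The weight shared by all positions `(a,b,j)` with `j - a = A` and `j - b = B`. -/
noncomputable def lineWeight (A B : ℤ) : KP := chiP - (A : KP) * qP - (B : KP) * hP

theorem lineWeight_injective {A B A' B' : ℤ} :
    lineWeight A B = lineWeight A' B' ↔ A = A' ∧ B = B' := by
  refine ⟨fun h => ?_, fun h => by rw [h.1, h.2]⟩
  have hmap (A B : ℤ) : lineWeight A B = algebraMap (MvPolynomial (Fin 3) ℚ) KP
      (MvPolynomial.X 2 - (A : MvPolynomial (Fin 3) ℚ) * MvPolynomial.X 0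
        - (B : MvPolynomial (Fin 3) ℚ) * MvPolynomial.X 1) := by
    simp [lineWeight, chiP, qP, hP]
  rw [hmap, hmap] at h
  have h' := IsFractionRing.injective (MvPolynomial (Fin 3) ℚ) KP h
  have h₀ := congrArg (MvPolynomial.eval ![1, 0, 0]) h'
  have h₁ := congrArg (MvPolynomial.eval ![0, 1, 0]) h'
  simp at h₀ h₁
  exact ⟨h₀, h₁⟩

theorem posWeight_eq_lineWeight (p : PyrPos) :
    posWeight p = lineWeight ((p.2.2 : ℤ) - p.1) ((p.2.2 : ℤ) - p.2.1) := by
  rw [posWeight, lineWeight, tP]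
  push_cast
  ring

theorem lineWeight_add_q (A B : ℤ) : lineWeight A B + qP = lineWeight (A - 1) B := by
  rw [lineWeight, lineWeight]
  push_cast
  ring

theorem lineWeight_add_h (A B : ℤ) : lineWeight A B + hP = lineWeight A (B - 1) := by
  rw [lineWeight, lineWeight]
  push_cast
  ring

theorem lineWeight_add_t (A B : ℤ) : lineWeight A B + tP = lineWeight (A + 1) (B + 1) := by
  rw [lineWeight, lineWeight, tP]
  push_cast
  ring

theorem lineWeight_sub_q (A B : ℤ) : lineWeight A B - qP = lineWeight (A + 1) B := by
  rw [lineWeight, lineWeight]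
  push_cast
  ring

theorem lineWeight_sub_h (A B : ℤ) : lineWeight A B - hP = lineWeight A (B + 1) := by
  rw [lineWeight, lineWeight]
  push_cast
  ring

theorem lineWeight_sub_t (A B : ℤ) : lineWeight A B - tP = lineWeight (A - 1) (B - 1) := by
  rw [lineWeight, lineWeight, tP]
  push_cast
  ring

theorem chiP_add_mul_tP (m : ℕ) : chiP + (m : KP) * tP = lineWeight m m := by
  rw [lineWeight, tP]
  push_cast
  ring

open scoped Classical in
theorem sum_ite_lineWeight (P : Finset PyrPos) (A B : ℤ) (u v : ℤ) :
    (∑ p ∈ P, if lineWeight A B =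
      lineWeight ((p.2.2 : ℤ) - p.1 + u) ((p.2.2 : ℤ) - p.2.1 + v) then 1 else 0) =
      lineCount P (A - u) (B - v) := by
  rw [lineCount, Finset.card_filter]
  refine Finset.sum_congr rfl fun p _ => if_congr ?_ rfl rfl
  rw [lineWeight_injective]
  omega

open Polynomial in
/-- Numerator of `z ^ k * h_Π(z)`, before cancellation. -/
noncomputable def hPyrNum (m : ℕ) (PB PW : Finset PyrPos) (k : ℕ) : Polynomial KP :=
  C ((-1) ^ (PB \ PW).card * (-1) ^ (m + 1)) * X ^ k * (X - C (chiP + (m : KP) * tP)) *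
    (∏ p ∈ PW, (X - C (posWeight p - tP)) * (X - C (posWeight p - qP)) *
      (X - C (posWeight p - hP))) *
    ∏ p ∈ PB \ PW, (X - C (posWeight p)) * (X - C (posWeight p - qP)) * (X - C (posWeight p - hP))

open Polynomial in
/-- Denominator of `z ^ k * h_Π(z)`, before cancellation. -/
noncomputable def hPyrDen (PB PW : Finset PyrPos) : Polynomial KP :=
  (∏ p ∈ PW, (X - C (posWeight p + tP)) * (X - C (posWeight p + qP)) *
      (X - C (posWeight p + hP))) *
    ∏ p ∈ PB \ PW, (X - C (posWeight p + tP))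

theorem X_pow_mul_hPyr_eq (m : ℕ) (PB PW : Finset PyrPos) (k : ℕ) :
    RatFunc.X ^ k * hPyr m PB PW =
      algebraMap (Polynomial KP) (RatFunc KP) (hPyrNum m PB PW k) /
        algebraMap (Polynomial KP) (RatFunc KP) (hPyrDen PB PW) := by
  simp only [hPyr, hPyrNum, hPyrDen, map_mul, map_prod, map_sub, map_add, map_pow, map_neg,
    map_one, RatFunc.algebraMap_X, RatFunc.algebraMap_C, Finset.prod_div_distrib]
  simp only [sub_add_eq_sub_sub, sub_sub_eq_add_sub, sub_add_eq_add_sub]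
  simp only [← mul_div_assoc, div_mul_eq_mul_div, div_div]
  congr 1
  ring

theorem hPyrNum_ne_zero (m : ℕ) (PB PW : Finset PyrPos) (k : ℕ) : hPyrNum m PB PW k ≠ 0 := by
  simp [hPyrNum, Finset.prod_ne_zero_iff, Polynomial.X_sub_C_ne_zero,
    -map_sub, -map_add, -map_mul]

theorem hPyrDen_ne_zero (PB PW : Finset PyrPos) : hPyrDen PB PW ≠ 0 := by
  simp [hPyrDen, Finset.prod_ne_zero_iff, Polynomial.X_sub_C_ne_zero, -map_add]

theorem splits_hPyrDen (PB PW : Finset PyrPos) : (hPyrDen PB PW).Splits :=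
  .mul (.prod fun _ _ => .mul (.mul (.X_sub_C _) (.X_sub_C _)) (.X_sub_C _))
    (.prod fun _ _ => .X_sub_C _)

theorem exists_lineWeight_of_isRoot_hPyrDen {PB PW : Finset PyrPos} {w : KP}
    (hw : (hPyrDen PB PW).IsRoot w) : ∃ A B : ℤ, w = lineWeight A B := by
  simp only [hPyrDen, Polynomial.IsRoot, Polynomial.eval_mul, Polynomial.eval_prod, mul_eq_zero,
    Finset.prod_eq_zero_iff, Polynomial.eval_sub, Polynomial.eval_X, Polynomial.eval_C,
    sub_eq_zero, posWeight_eq_lineWeight, lineWeight_add_t, lineWeight_add_q,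
    lineWeight_add_h] at hw
  rcases hw with ⟨p, -, (h | h) | h⟩ | ⟨p, -, h⟩ <;> exact ⟨_, _, h⟩

theorem rootMultiplicity_hPyrDen (PB PW : Finset PyrPos) (A B : ℤ) :
    (hPyrDen PB PW).rootMultiplicity (lineWeight A B) =
      lineCount PW (A - 1) (B - 1) + lineCount PW (A + 1) B + lineCount PW A (B + 1) +
        lineCount (PB \ PW) (A - 1) (B - 1) := by
  classical
  have hne := hPyrDen_ne_zero PB PW
  unfold hPyrDen at hne ⊢
  rw [Polynomial.rootMultiplicity_mul hne, Polynomial.rootMultiplicity_prod _ _ _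
    (Finset.prod_ne_zero_iff.mp (left_ne_zero_of_mul hne)), Polynomial.rootMultiplicity_prod _ _ _
    (Finset.prod_ne_zero_iff.mp (right_ne_zero_of_mul hne))]
  simp only [Polynomial.rootMultiplicity_X_sub_C_mul₃, Polynomial.rootMultiplicity_X_sub_C,
    posWeight_eq_lineWeight, lineWeight_add_t, lineWeight_add_q, lineWeight_add_h,
    Finset.sum_add_distrib]
  have hq := sum_ite_lineWeight PW A B (-1) 0
  have hh := sum_ite_lineWeight PW A B 0 (-1)
  simp only [add_zero, ← sub_eq_add_neg, sub_neg_eq_add, sub_zero] at hq hh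
  rw [sum_ite_lineWeight, sum_ite_lineWeight, hq, hh]

theorem le_rootMultiplicity_hPyrNum (m : ℕ) (PB PW : Finset PyrPos) (k : ℕ) (A B : ℤ) :
    (if A = m ∧ B = m then 1 else 0) + (lineCount PW (A + 1) (B + 1) + lineCount PW (A - 1) B +
      lineCount PW A (B - 1)) + (lineCount (PB \ PW) A B + lineCount (PB \ PW) (A - 1) B +
        lineCount (PB \ PW) A (B - 1)) ≤
      (hPyrNum m PB PW k).rootMultiplicity (lineWeight A B) := by
  classical
  have hne := hPyrNum_ne_zero m PB PW k
  unfold hPyrNum at hne ⊢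
  have hne' := left_ne_zero_of_mul hne
  have hne'' := left_ne_zero_of_mul hne'
  rw [Polynomial.rootMultiplicity_mul hne, Polynomial.rootMultiplicity_mul hne',
    Polynomial.rootMultiplicity_mul hne'', Polynomial.rootMultiplicity_prod _ _ _
    (Finset.prod_ne_zero_iff.mp (right_ne_zero_of_mul hne')), Polynomial.rootMultiplicity_prod _ _ _
    (Finset.prod_ne_zero_iff.mp (right_ne_zero_of_mul hne))]
  simp only [Polynomial.rootMultiplicity_X_sub_C_mul₃, Polynomial.rootMultiplicity_X_sub_C,
    posWeight_eq_lineWeight, lineWeight_sub_t, lineWeight_sub_q, lineWeight_sub_h,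
    Finset.sum_add_distrib, chiP_add_mul_tP]
  have ht (P : Finset PyrPos) := sum_ite_lineWeight P A B (-1) (-1)
  have h0 (P : Finset PyrPos) := sum_ite_lineWeight P A B 0 0
  have hq (P : Finset PyrPos) := sum_ite_lineWeight P A B 1 0
  have hh (P : Finset PyrPos) := sum_ite_lineWeight P A B 0 1
  simp only [add_zero, ← sub_eq_add_neg, sub_neg_eq_add, sub_zero] at ht h0 hq hh
  rw [ht, h0, hq, hq, hh, hh]
  simp only [lineWeight_injective]
  omega

theorem lineCount_sdiff {PB PW : Finset PyrPos} (h : PW ⊆ PB) (A B : ℤ) :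
    lineCount (PB \ PW) A B + lineCount PW A B = lineCount PB A B := by
  simp only [lineCount, Finset.card_filter]
  exact Finset.sum_sdiff h

theorem IsPyramid.rootMultiplicity_le_or_exists {m : ℕ} {PB PW : Finset PyrPos}
    (h : IsPyramid m PB PW) (hm : 1 ≤ m) (k : ℕ) (w : KP) :
    (hPyrDen PB PW).rootMultiplicity w ≤ (hPyrNum m PB PW k).rootMultiplicity w ∨
      ∃ p ∈ AddPairs m PB PW ∪ RemPairs m PB PW, posWeight p = w := by
  by_cases hroot : (hPyrDen PB PW).IsRoot w
  · obtain ⟨A, B, rfl⟩ := exists_lineWeight_of_isRoot_hPyrDen hroot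
    refine or_iff_not_imp_left.mpr fun hlt => ?_
    have hsub : PW ⊆ PB := fun _ hp => h.black_of_white hp
    have hnum := le_rootMultiplicity_hPyrNum m PB PW k A B
    rw [rootMultiplicity_hPyrDen] at hlt
    have s₁ := lineCount_sdiff hsub A B
    have s₂ := lineCount_sdiff hsub (A - 1) B
    have s₃ := lineCount_sdiff hsub A (B - 1)
    have s₄ := lineCount_sdiff hsub (A - 1) (B - 1)
    obtain ⟨p, hp, rfl, rfl⟩ := h.exists_mem_of_order_neg hm (A := A) (B := B)
      (by split_ifs at hnum ⊢ <;> omega)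
    exact ⟨p, hp, posWeight_eq_lineWeight p⟩
  · rw [Polynomial.rootMultiplicity_eq_zero hroot]
    exact Or.inl (Nat.zero_le _)

end Poles

open scoped Classical

/-- **Residue identity for the `[e,f] = h` relation of the `(+1)`-shifted affine
Yangian acting on the cohomology of the Pandharipande–Thomas moduli space of the
resolved conifold**: for every pyramid partition `Π` of length `m` and every
`k ≥ 0`, the sum over the set `W` of weights of the addible and removable pairs of
`Π` of the residues of `z^k·h_Π(z)` equals the coefficient of `z^{−1}` in the
expansion of `z^k·h_Π(z)` as a formal Laurent series in `z⁻¹`. -/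
theorem sum_residues_hPyr_eq_coeff_atInf
    (m : ℕ) (hm : 1 ≤ m) (PB PW : Finset PyrPos) (hPi : IsPyramid m PB PW) (k : ℕ)
    (S : Finset PyrPos)
    (hS : (↑S : Set PyrPos) = AddPairs m PB PW ∪ RemPairs m PB PW) :
    ∑ w ∈ S.image posWeight, resAtP w (RatFunc.X ^ k * hPyr m PB PW)
      = (expAtInfP (RatFunc.X ^ k * hPyr m PB PW)).coeff 1 := by
  have key := sum_residue_eq_coeff_of_rootMultiplicity_le (hPyrNum_ne_zero m PB PW k)
    (hPyrDen_ne_zero PB PW) (splits_hPyrDen PB PW) (S.image posWeight)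
    (fun w => (hPi.rootMultiplicity_le_or_exists hm k w).imp_right fun ⟨p, hp, hpw⟩ =>
      Finset.mem_image.mpr ⟨p, by rwa [← Finset.mem_coe, hS], hpw⟩)
    (X_pow_mul_hPyr_eq m PB PW k)
  rw [expandAtInfinity_apply] at key
  exact key
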